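/- arXiv:1610.00108 — 2 statements merged into one kernel-verified Lean document; each statement's English description precedes it below -/
import Mathlib

section
/- For every integer n ≥ 1, the generating function of the hyperbinary counts equals the bivariate Stern polynomial: Σ_{i,j ≥ 0} h_n(i,j)·x^i·y^j = s_n(x,y); equivalently, h_n(i,j) is the coefficient of x^i y^j in s_n(x,y). -/
open MvPolynomial

/-- Bivariate Stern polynomials: `s 1 = 1`, `s (2n) = s n`,
`s (2n+1) = x * s n + y * s (n+1)`, where `x = X 0` and `y = X 1`
in `ℤ[x,y] = MvPolynomial (Fin 2) ℤ`. (The value at `0` is a junk value.) -/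
noncomputable def sternPoly : ℕ → MvPolynomial (Fin 2) ℤ
  | 0 => 0
  | 1 => 1
  | (n + 2) =>
      if (n + 2) % 2 = 0 then sternPoly ((n + 2) / 2)
      else X 0 * sternPoly ((n + 2) / 2) + X 1 * sternPoly ((n + 2) / 2 + 1)
decreasing_by all_goals omega

/-- `hyperCount t i j` is the number of proper hyperbinary expansions of `t - 1`
with exactly `i` digits equal to `2` and `j` digits equal to `0`.
An expansion `(ε_{ν-1}, …, ε_0)` is encoded as the little-endian list
`L = [ε_0, …, ε_{ν-1}]` of digits in `{0,1,2}` with `Nat.ofDigits 2 L = t - 1`;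
it is proper when it is empty or its leading digit `ε_{ν-1}` (the last entry
of `L`) is nonzero. -/
noncomputable def hyperCount (t i j : ℕ) : ℕ :=
  Nat.card {L : List ℕ // (∀ d ∈ L, d ≤ 2) ∧ Nat.ofDigits 2 L = t - 1 ∧
    L.getLast? ≠ some 0 ∧ L.count 2 = i ∧ L.count 0 = j}

/-- The proper hyperbinary expansions of `m`, as little-endian lists of digits. -/
def hyperExpansions (m : ℕ) : Set (List ℕ) :=
  {L | (∀ d ∈ L, d ≤ 2) ∧ Nat.ofDigits 2 L = m ∧ L.getLast? ≠ some 0}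

theorem nil_mem_hyperExpansions_iff {m : ℕ} : [] ∈ hyperExpansions m ↔ m = 0 := by
  simp [hyperExpansions, eq_comm]

theorem cons_mem_hyperExpansions_iff {d m : ℕ} {L : List ℕ} :
    d :: L ∈ hyperExpansions m ↔
      d ≤ 2 ∧ (L = [] → d ≠ 0) ∧ ∃ k, m = d + 2 * k ∧ L ∈ hyperExpansions k := by
  cases L with
  | nil =>
    simp [hyperExpansions]
    grind
  | cons a L =>
    simp only [hyperExpansions, Set.mem_ofPred_eq, Nat.ofDigits_cons (hd := d),
      List.getLast?_cons_cons, List.forall_mem_cons (a := d)]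
    grind

theorem hyperExpansions_zero : hyperExpansions 0 = {[]} := by
  ext L
  induction L with
  | nil => simp [nil_mem_hyperExpansions_iff]
  | cons d L ih =>
    rw [cons_mem_hyperExpansions_iff]
    simp only [Set.mem_singleton_iff, reduceCtorEq, iff_false]
    rintro ⟨-, h, k, hk, hL⟩
    obtain rfl : k = 0 := by omega
    exact h (ih.1 hL) (by omega)

theorem hyperExpansions_two_mul_add_one (m : ℕ) :
    hyperExpansions (2 * m + 1) = List.cons 1 '' hyperExpansions m := by
  ext L
  cases L with
  | nil => simp [nil_mem_hyperExpansions_iff]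
  | cons d L =>
    simp only [cons_mem_hyperExpansions_iff, Set.mem_image, List.cons.injEq]
    constructor
    · rintro ⟨hd, -, k, hk, hL⟩
      obtain rfl : d = 1 := by omega
      obtain rfl : k = m := by omega
      exact ⟨L, hL, rfl, rfl⟩
    · rintro ⟨_, hL, rfl, rfl⟩
      exact ⟨by omega, by simp, m, by omega, hL⟩

theorem hyperExpansions_two_mul_add_two (m : ℕ) :
    hyperExpansions (2 * m + 2) =
      List.cons 2 '' hyperExpansions m ∪ List.cons 0 '' hyperExpansions (m + 1) := by
  ext L
  cases L with
  | nil => simp [nil_mem_hyperExpansions_iff]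
  | cons d L =>
    simp only [cons_mem_hyperExpansions_iff, Set.mem_union, Set.mem_image, List.cons.injEq]
    constructor
    · rintro ⟨hd, -, k, hk, hL⟩
      obtain ⟨rfl, rfl⟩ | ⟨rfl, rfl⟩ : d = 2 ∧ k = m ∨ d = 0 ∧ k = m + 1 := by omega
      · exact .inl ⟨L, hL, rfl, rfl⟩
      · exact .inr ⟨L, hL, rfl, rfl⟩
    · rintro (⟨_, hL, rfl, rfl⟩ | ⟨_, hL, rfl, rfl⟩)
      · exact ⟨le_rfl, by simp, m, by omega, hL⟩
      · refine ⟨by omega, ?_, m + 1, by omega, hL⟩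
        rintro rfl
        simp [nil_mem_hyperExpansions_iff] at hL

theorem finite_hyperExpansions (m : ℕ) : (hyperExpansions m).Finite := by
  induction m using Nat.strong_induction_on with
  | _ m ih =>
    obtain rfl | ⟨k, rfl⟩ | ⟨k, rfl⟩ :
        m = 0 ∨ (∃ k, m = 2 * k + 1) ∨ ∃ k, m = 2 * k + 2 := by
      obtain ⟨k, hk⟩ := Nat.even_or_odd' m
      rcases hk with rfl | rfl
      · cases k with
        | zero => exact .inl rfl
        | succ k => exact .inr (.inr ⟨k, rfl⟩)
      · exact .inr (.inl ⟨k, rfl⟩)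
    · simp [hyperExpansions_zero]
    · rw [hyperExpansions_two_mul_add_one]
      exact (ih k (by omega)).image _
    · rw [hyperExpansions_two_mul_add_two]
      exact ((ih k (by omega)).image _).union ((ih (k + 1) (by omega)).image _)

theorem sternPoly_one : sternPoly 1 = 1 := by
  rw [sternPoly]

theorem sternPoly_two_mul (k : ℕ) : sternPoly (2 * (k + 1)) = sternPoly (k + 1) := by
  rw [show 2 * (k + 1) = 2 * k + 2 by ring, sternPoly, if_pos (by omega)]
  congr 1
  omega

theorem sternPoly_two_mul_add_one (k : ℕ) :
    sternPoly (2 * (k + 1) + 1) = X 0 * sternPoly (k + 1) + X 1 * sternPoly (k + 2) := by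
  rw [show 2 * (k + 1) + 1 = (2 * k + 1) + 2 by ring, sternPoly, if_neg (by omega),
    show (2 * k + 1 + 2) / 2 = k + 1 by omega]

theorem sternPoly_succ_eq_finsum (m : ℕ) :
    sternPoly (m + 1) = ∑ᶠ L ∈ hyperExpansions m, X 0 ^ L.count 2 * X 1 ^ L.count 0 := by
  induction m using Nat.strong_induction_on with
  | _ m ih =>
    obtain ⟨k, rfl | rfl⟩ := Nat.even_or_odd' m
    · cases k with
      | zero => simp [hyperExpansions_zero, sternPoly_one]
      | succ k =>
        rw [sternPoly_two_mul_add_one, ih k (by omega), ih (k + 1) (by omega), mul_add_one,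
          hyperExpansions_two_mul_add_two, finsum_mem_union _
            ((finite_hyperExpansions k).image _) ((finite_hyperExpansions (k + 1)).image _),
          finsum_mem_image List.cons_injective.injOn, finsum_mem_image List.cons_injective.injOn,
          mul_finsum_mem, mul_finsum_mem]
        · simp [pow_succ', mul_assoc, mul_left_comm]
        · rw [Set.disjoint_left]
          rintro _ ⟨L, -, rfl⟩ ⟨L', -, h⟩
          simp at h
    · rw [show 2 * k + 1 + 1 = 2 * (k + 1) by ring, sternPoly_two_mul, ih k (by omega),
        hyperExpansions_two_mul_add_one, finsum_mem_image List.cons_injective.injOn]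
      simp

theorem coeff_X_pow_mul_X_pow (i j a b : ℕ) :
    coeff (Finsupp.single 0 i + Finsupp.single 1 j)
      (X 0 ^ a * X 1 ^ b : MvPolynomial (Fin 2) ℤ) = if a = i ∧ b = j then 1 else 0 := by
  rw [X_pow_eq_monomial, X_pow_eq_monomial, monomial_mul, coeff_monomial, one_mul]
  congr 1
  simp [Finsupp.ext_iff, Fin.forall_fin_two]

/-- **Proposition 1.** For every `n ≥ 1`, `Σ_{i,j ≥ 0} h_n(i,j)·x^i·y^j = s_n(x,y)`;
equivalently, `h_n(i,j)` is the coefficient of `x^i y^j` in `s_n(x,y)`. -/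
theorem sternPoly_coeff_eq_hyperCount (n : ℕ) (hn : 1 ≤ n) (i j : ℕ) :
    MvPolynomial.coeff (Finsupp.single 0 i + Finsupp.single 1 j) (sternPoly n)
      = (hyperCount n i j : ℤ) := by
  obtain ⟨m, rfl⟩ := Nat.exists_eq_add_of_le' hn
  have hfin := finite_hyperExpansions m
  rw [sternPoly_succ_eq_finsum, finsum_mem_eq_finite_toFinset_sum _ hfin, coeff_sum]
  simp only [coeff_X_pow_mul_X_pow]
  rw [Finset.sum_boole, hyperCount, ← Nat.card_eq_finsetCard]
  refine congrArg _ (Nat.card_congr (Equiv.subtypeEquivRight fun L => ?_))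
  simp [hyperExpansions, and_assoc]
end

section
/- (Dijkstra) For every positive integer n, the Stern diatomic sequence satisfies s_n = s_{n^R}, where n^R is the integer obtained from n by reversing its binary expansion. -/
open MvPolynomial

/-- Stern's diatomic sequence: `s 1 = 1`, `s (2n) = s n`, `s (2n+1) = s n + s (n+1)`.
(The value at `0` is a junk value.) -/
def stern : ℕ → ℕ
  | 0 => 0
  | 1 => 1
  | (n + 2) =>
      if (n + 2) % 2 = 0 then stern ((n + 2) / 2)
      else stern ((n + 2) / 2) + stern ((n + 2) / 2 + 1)
decreasing_by all_goals omega

/-- `binRev n` is the integer obtained from `n` by reversing its binary expansion: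
if `n = (ε_ν ε_{ν-1} … ε_0)₂` with `ε_ν = 1`, then `binRev n = Σ_{0 ≤ i ≤ ν} ε_{ν-i}·2^i`. -/
def binRev (n : ℕ) : ℕ := Nat.ofDigits 2 ((Nat.digits 2 n).reverse)

theorem stern_two_mul (n : ℕ) : stern (2 * n) = stern n := by
  rcases n with _ | n
  · rfl
  · rw [show 2 * (n + 1) = 2 * n + 2 by ring, stern, if_pos (by omega),
      show (2 * n + 2) / 2 = n + 1 by omega]

theorem stern_two_mul_add_one (n : ℕ) : stern (2 * n + 1) = stern n + stern (n + 1) := by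
  rcases n with _ | n
  · simp [stern]
  · rw [show 2 * (n + 1) + 1 = (2 * n + 1) + 2 by ring, stern, if_neg (by omega),
      show (2 * n + 1 + 2) / 2 = n + 1 by omega]

/-- The matrix taking `(stern n, stern (n + 1))` to `(stern (2n + b), stern (2n + b + 1))`
for a binary digit `b`. -/
def sternMatrix (b : ℕ) : Matrix (Fin 2) (Fin 2) ℕ :=
  if b = 0 then !![1, 0; 1, 1] else !![1, 1; 0, 1]

theorem stern_ofDigits (l : List ℕ) (hl : ∀ b ∈ l, b < 2) :
    stern (Nat.ofDigits 2 l) = (l.map sternMatrix).prod 0 1 ∧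
      stern (Nat.ofDigits 2 l + 1) = (l.map sternMatrix).prod 1 1 := by
  induction l with
  | nil => simp [stern]
  | cons b l ih =>
    obtain ⟨h₀, h₁⟩ := ih fun c hc => hl c (List.mem_cons_of_mem _ hc)
    have hb : b < 2 := hl b List.mem_cons_self
    rw [Nat.ofDigits_cons, List.map_cons, List.prod_cons, Matrix.mul_apply, Matrix.mul_apply,
      Fin.sum_univ_two, Fin.sum_univ_two, ← h₀, ← h₁]
    generalize Nat.ofDigits 2 l = m
    interval_cases b
    · simp [sternMatrix, stern_two_mul, stern_two_mul_add_one]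
    · have h : 1 + 2 * m + 1 = 2 * (m + 1) := by ring
      rw [h, stern_two_mul, add_comm 1, stern_two_mul_add_one]
      simp [sternMatrix]

/-- Reflection in the antidiagonal reverses products and fixes each `sternMatrix b`. -/
theorem prod_map_sternMatrix_reverse (l : List ℕ) :
    (l.reverse.map sternMatrix).prod =
      ((l.map sternMatrix).prod.transpose).submatrix Fin.revPerm Fin.revPerm := by
  induction l with
  | nil => simp
  | cons b l ih =>
    have hb : (sternMatrix b).transpose.submatrix Fin.revPerm Fin.revPerm = sternMatrix b := by
      unfold sternMatrix
      split_ifs <;> decide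
    rw [List.reverse_cons, List.map_append, List.prod_append, ih, List.map_singleton,
      List.prod_singleton, List.map_cons, List.prod_cons, Matrix.transpose_mul,
      ← Matrix.submatrix_mul_equiv _ _ _ Fin.revPerm, hb]

/-- **Theorem A (Dijkstra).** Stern's diatomic sequence is invariant under binary
digit reversal: `s n = s (binRev n)` for every positive integer `n`. -/
theorem stern_binRev (n : ℕ) (hn : 1 ≤ n) : stern n = stern (binRev n) := by
  have hl : ∀ b ∈ Nat.digits 2 n, b < 2 := fun b hb => Nat.digits_lt_base one_lt_two hb
  rw [binRev, (stern_ofDigits _ fun b hb => hl b (List.mem_reverse.mp hb)).1,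
    prod_map_sternMatrix_reverse]
  conv_lhs => rw [← Nat.ofDigits_digits 2 n, (stern_ofDigits _ hl).1]
  rfl
end
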